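/- If a 2-form ψ on ℝ⁸ lies in span{β₀,…,β₆} (i.e. ψ ∈ spin(7)⊥), then for all vectors y, z ∈ ℝ⁸: Σ_{i,j∈ℤ₈} ψ(e_i, e_j) Φ(e_i, e_j, y, z) = −6σ ψ(y, z), where e₇ := e. (This expresses the equivalence of the two formulas for the intrinsic torsion ξ^{Spin(7)} in terms of r̄ and in terms of the cross product P.) -/

import Mathlib

open scoped BigOperators RealInnerProductSpace

noncomputable section

abbrev Form (n p : ℕ) := (Fin p → EuclideanSpace ℝ (Fin n)) → ℝ

namespace Form

/-- Wedge product of forms (shuffle convention; full antisymmetrization divided by p!q!). -/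
def wedge {n p q : ℕ} (α : Form n p) (β : Form n q) : Form n (p + q) :=
  fun x =>
    (((p.factorial * q.factorial : ℕ) : ℝ))⁻¹ *
      ∑ σ : Equiv.Perm (Fin (p + q)),
        ((Equiv.Perm.sign σ : ℤ) : ℝ) *
          (α fun i => x (σ (Fin.castAdd q i))) * (β fun j => x (σ (Fin.natAdd p j)))

/-- Inner product of `p`-forms. -/
def inner' {n p : ℕ} (α β : Form n p) : ℝ :=
  ((p.factorial : ℕ) : ℝ)⁻¹ *
    ∑ f : Fin p → Fin n,
      (α fun k => EuclideanSpace.single (f k) 1) * (β fun k => EuclideanSpace.single (f k) 1)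

/-- Interior product of a vector and a form. -/
def iprod {n p : ℕ} (v : EuclideanSpace ℝ (Fin n)) (α : Form n (p + 1)) : Form n p :=
  fun x => α (Fin.cons v x)

end Form

infixl:72 " ⋏ " => Form.wedge

/-- The 1-form dual to a vector. -/
def dual {n : ℕ} (v : EuclideanSpace ℝ (Fin n)) : Form n 1 := fun x => ⟪v, x 0⟫

abbrev E8 := EuclideanSpace ℝ (Fin 8)

/-- The basis vector `e`. -/
def e8 : E8 := EuclideanSpace.single 7 1

/-- The basis vectors `e₀,…,e₆` indexed mod 7. -/
def u7 (i : ZMod 7) : E8 := EuclideanSpace.single ⟨i.val, i.val_lt.trans (by norm_num)⟩ 1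

/-- The basis indexed by ℤ₈, with `e₇ = e`. -/
def u8 (i : ZMod 8) : E8 := EuclideanSpace.single ⟨i.val, i.val_lt⟩ 1

/-- The Spin(7) fundamental 4-form. -/
def Phi (σ : ℝ) : Form 8 4 := fun x =>
  (∑ i : ZMod 7, (dual e8 ⋏ dual (u7 i) ⋏ dual (u7 (i + 1)) ⋏ dual (u7 (i + 3))) x)
    - σ * ∑ i : ZMod 7,
        (dual (u7 (i + 2)) ⋏ dual (u7 (i + 4)) ⋏ dual (u7 (i + 5)) ⋏ dual (u7 (i + 6))) x

/-- The standard volume form of ℝ⁸. -/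
def vol8 : Form 8 8 :=
  dual e8 ⋏ dual (u7 0) ⋏ dual (u7 1) ⋏ dual (u7 2) ⋏ dual (u7 3) ⋏ dual (u7 4) ⋏ dual (u7 5)
    ⋏ dual (u7 6)

/-- The 2-forms spanning spin(7)ᗮ. -/
def beta (σ : ℝ) (i : ZMod 7) : Form 8 2 := fun x =>
  σ * (dual (u7 i) ⋏ dual e8) x + (dual (u7 (i + 1)) ⋏ dual (u7 (i + 3))) x
    + (dual (u7 (i + 4)) ⋏ dual (u7 (i + 5))) x + (dual (u7 (i + 2)) ⋏ dual (u7 (i + 6))) x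

/-- The Gram determinant of `v` against `x`; the value of `v₀ ∧ ⋯ ∧ vₚ₋₁` at `x`. -/
def gramForm {n p : ℕ} (v : Fin p → EuclideanSpace ℝ (Fin n)) : Form n p := fun x =>
  (Matrix.of fun i j => ⟪v j, x i⟫).det

theorem dual_eq_gramForm {n : ℕ} (v : EuclideanSpace ℝ (Fin n)) : dual v = gramForm ![v] := by
  funext x
  simp [dual, gramForm]

theorem gramForm_wedge_dual {n p : ℕ} (v : Fin p → EuclideanSpace ℝ (Fin n))
    (d : EuclideanSpace ℝ (Fin n)) :
    gramForm v ⋏ dual d = gramForm (Fin.snoc (α := fun _ => EuclideanSpace ℝ (Fin n)) v d) := by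
  funext x
  have key (τ : Equiv.Perm (Fin p)) :
      ∑ π : Equiv.Perm (Fin (p + 1)), ((Equiv.Perm.sign π : ℤ) : ℝ) *
          (((Equiv.Perm.sign τ : ℤ) : ℝ) * ∏ i, ⟪v i, x (π (Fin.castAdd 1 (τ i)))⟫) *
            ⟪d, x (π (Fin.natAdd p 0))⟫ =
        ∑ π : Equiv.Perm (Fin (p + 1)), ((Equiv.Perm.sign π : ℤ) : ℝ) *
          ((∏ i, ⟪v i, x (π (Fin.castAdd 1 i))⟫) * ⟪d, x (π (Fin.natAdd p 0))⟫) := by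
    let τ' : Equiv.Perm (Fin (p + 1)) :=
      finSumFinEquiv.permCongr (Equiv.Perm.sumCongr τ (1 : Equiv.Perm (Fin 1)))
    have sign_τ' : Equiv.Perm.sign τ' = Equiv.Perm.sign τ := by
      simp [τ', Equiv.Perm.sign_permCongr, Equiv.Perm.sign_sumCongr]
    have τ'_left (i : Fin p) : τ' (Fin.castAdd 1 i) = Fin.castAdd 1 (τ i) := by
      simp [τ', Equiv.permCongr_apply]
    have τ'_right : τ' (Fin.natAdd p 0) = Fin.natAdd p 0 := by
      simp only [τ', Equiv.permCongr_apply, finSumFinEquiv_symm_apply_natAdd]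
      simp
    refine Fintype.sum_equiv (Equiv.mulRight τ') _ _ fun π => ?_
    simp only [Equiv.coe_mulRight, Equiv.Perm.coe_mul, Function.comp_apply, τ'_left, τ'_right,
      Equiv.Perm.sign_mul, sign_τ']
    push_cast
    ring
  simp only [Form.wedge, gramForm, dual, Matrix.det_apply', Matrix.of_apply]
  simp only [Finset.mul_sum, Finset.sum_mul]
  rw [Finset.sum_comm]
  simp only [← Finset.mul_sum, key]
  rw [Finset.sum_const, Finset.card_univ, Fintype.card_perm, Fintype.card_fin, nsmul_eq_mul,
    Nat.factorial_one, mul_one, inv_mul_cancel_left₀ (by positivity)]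
  refine Finset.sum_congr rfl fun π _ => ?_
  rw [Fin.prod_univ_castSucc]
  simp only [Fin.snoc_castSucc, Fin.snoc_last]
  rfl

theorem dual_wedge_dual_apply {n : ℕ} (a b : Fin n) (x : Fin 2 → EuclideanSpace ℝ (Fin n)) :
    (dual (EuclideanSpace.single a 1) ⋏ dual (EuclideanSpace.single b 1)) x =
      x 0 a * x 1 b - x 1 a * x 0 b := by
  rw [dual_eq_gramForm (EuclideanSpace.single a 1), gramForm_wedge_dual]
  simp [gramForm, Matrix.det_fin_two, Fin.snoc, EuclideanSpace.inner_single_left]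
  ring

theorem dual_wedge_four_apply {n : ℕ} (a b c d : Fin n) (x : Fin 4 → EuclideanSpace ℝ (Fin n)) :
    (dual (EuclideanSpace.single a 1) ⋏ dual (EuclideanSpace.single b 1) ⋏
        dual (EuclideanSpace.single c 1) ⋏ dual (EuclideanSpace.single d 1)) x =
      (x 0 a * x 1 b - x 1 a * x 0 b) * (x 2 c * x 3 d - x 3 c * x 2 d)
      - (x 0 a * x 1 c - x 1 a * x 0 c) * (x 2 b * x 3 d - x 3 b * x 2 d)
      + (x 0 a * x 1 d - x 1 a * x 0 d) * (x 2 b * x 3 c - x 3 b * x 2 c)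
      + (x 0 b * x 1 c - x 1 b * x 0 c) * (x 2 a * x 3 d - x 3 a * x 2 d)
      - (x 0 b * x 1 d - x 1 b * x 0 d) * (x 2 a * x 3 c - x 3 a * x 2 c)
      + (x 0 c * x 1 d - x 1 c * x 0 d) * (x 2 a * x 3 b - x 3 a * x 2 b) := by
  rw [dual_eq_gramForm (EuclideanSpace.single a 1), gramForm_wedge_dual, gramForm_wedge_dual,
    gramForm_wedge_dual]
  simp [gramForm, Matrix.det_succ_row_zero, Fin.sum_univ_succ, Fin.snoc, Fin.succAbove,
    EuclideanSpace.inner_single_left]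
  ring

theorem sum_dual_wedge_dual_mul {n : ℕ} (p q : Fin n) (F : Fin n → Fin n → ℝ) :
    ∑ i, ∑ j, (dual (EuclideanSpace.single p 1) ⋏ dual (EuclideanSpace.single q 1))
        ![EuclideanSpace.single i 1, EuclideanSpace.single j 1] * F i j = F p q - F q p := by
  simp only [dual_wedge_dual_apply]
  simp [sub_mul, Finset.sum_sub_distrib]

/-- `Phi` indexed by `Fin 7`, where index arithmetic on literals reduces. -/
theorem Phi_eq_sum_fin (σ : ℝ) (x : Fin 4 → E8) :
    Phi σ x =
      (∑ i : Fin 7, (dual (EuclideanSpace.single (7 : Fin 8) 1) ⋏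
        dual (EuclideanSpace.single i.castSucc 1) ⋏
        dual (EuclideanSpace.single (i + 1).castSucc 1) ⋏
        dual (EuclideanSpace.single (i + 3).castSucc 1)) x)
      - σ * ∑ i : Fin 7, (dual (EuclideanSpace.single (i + 2).castSucc 1) ⋏
        dual (EuclideanSpace.single (i + 4).castSucc 1) ⋏
        dual (EuclideanSpace.single (i + 5).castSucc 1) ⋏
        dual (EuclideanSpace.single (i + 6).castSucc 1)) x :=
  rfl

/-- `beta` indexed by `Fin 7`, where index arithmetic on literals reduces. -/
theorem beta_eq_fin (σ : ℝ) (k : Fin 7) (x : Fin 2 → E8) :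
    beta σ k x =
      σ * (dual (EuclideanSpace.single k.castSucc 1) ⋏
        dual (EuclideanSpace.single (7 : Fin 8) 1)) x
      + (dual (EuclideanSpace.single (k + 1).castSucc 1) ⋏
        dual (EuclideanSpace.single (k + 3).castSucc 1)) x
      + (dual (EuclideanSpace.single (k + 4).castSucc 1) ⋏
        dual (EuclideanSpace.single (k + 5).castSucc 1)) x
      + (dual (EuclideanSpace.single (k + 2).castSucc 1) ⋏
        dual (EuclideanSpace.single (k + 6).castSucc 1)) x :=
  rfl

set_option maxHeartbeats 4000000 in
theorem sum_beta_mul_Phi {σ : ℝ} (hσ : σ ^ 2 = 1) (k : Fin 7) (y z : E8) :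
    ∑ i : Fin 8, ∑ j : Fin 8,
        beta σ k ![EuclideanSpace.single i 1, EuclideanSpace.single j 1] *
          Phi σ ![EuclideanSpace.single i 1, EuclideanSpace.single j 1, y, z]
      = -6 * σ * beta σ k ![y, z] := by
  simp only [beta_eq_fin, add_mul, mul_assoc, Finset.sum_add_distrib, ← Finset.mul_sum]
  rw [sum_dual_wedge_dual_mul, sum_dual_wedge_dual_mul, sum_dual_wedge_dual_mul,
    sum_dual_wedge_dual_mul]
  simp only [Phi_eq_sum_fin, dual_wedge_four_apply, dual_wedge_dual_apply, Fin.sum_univ_seven]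
  fin_cases k <;> simp <;> ring_nf <;> simp only [hσ] <;> ring

/-- if a 2-form `ψ` lies in `span{β₀,…,β₆} = spin(7)ᗮ`, then for all `y z`:
`Σ_{i,j∈ℤ₈} ψ(e_i,e_j) Φ(e_i,e_j,y,z) = −6σ ψ(y,z)`, where `e₇ := e`. -/
theorem stmt8 (σ : ℝ) (hσ : σ = 1 ∨ σ = -1) (ψ : Form 8 2)
    (hψ : ψ ∈ Submodule.span ℝ (Set.range (beta σ))) (y z : E8) :
    ∑ i : ZMod 8, ∑ j : ZMod 8, ψ ![u8 i, u8 j] * Phi σ ![u8 i, u8 j, y, z]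
      = -6 * σ * ψ ![y, z] := by
  induction hψ using Submodule.span_induction with
  | zero => simp
  | add f g _ _ hf hg => simp only [Pi.add_apply, add_mul, Finset.sum_add_distrib, hf, hg]; ring
  | smul c f _ hf =>
    simp only [Pi.smul_apply, smul_eq_mul, mul_assoc, ← Finset.mul_sum] at hf ⊢
    rw [hf]; ring
  | mem f hf =>
    obtain ⟨k, rfl⟩ := hf
    exact sum_beta_mul_Phi (by rcases hσ with rfl | rfl <;> norm_num) k y z
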